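/- Let b, c be integers with 1 ≤ b < c ≤ 2b, and let G be the graph with vertex set {v_1, …, v_{2b}} ∪ {x_1, …, x_{2(c−b)}} and edge set {{v_i, v_j} : 1 ≤ i < j ≤ 2b} ∪ {{v_k, x_ℓ} : 1 ≤ k ≤ b, 1 ≤ ℓ ≤ c − b} ∪ {{v_{b+k}, x_{c−b+ℓ}} : 1 ≤ k ≤ b, 1 ≤ ℓ ≤ c − b}. Then G is connected, ind-match(G) = 1, min-match(G) = b, match(G) = c, and dim(G) = 2(c − b). -/

import Mathlib

/-!
Formalization of results from "Matching numbers and dimension of edge ideals"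
by A. Hirano and K. Matsuda.

For a finite simple graph `G`:
* a matching is a set of pairwise disjoint edges;
* a maximal matching is one that cannot be enlarged by any edge;
* an induced matching is a matching such that no edge of `G` meets two
  distinct edges of the matching;
* `matchNum`, `minMatchNum`, `indMatchNum` are the corresponding maximum,
  minimum-maximal and maximum-induced sizes;
* `graphDim K G` is the Krull dimension of `K[V(G)]/I(G)`, where `I(G)` is
  the edge ideal of `G`.
-/

open MvPolynomial
open scoped Classical

noncomputable section

namespace EdgeIdealPaper

variable {V : Type*}

/-- `M` is a matching of `G`: a set of pairwise disjoint edges of `G`. -/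
def IsMatching (G : SimpleGraph V) (M : Finset (Sym2 V)) : Prop :=
  (M : Set (Sym2 V)) ⊆ G.edgeSet ∧
    ∀ e ∈ M, ∀ f ∈ M, e ≠ f → ∀ v : V, v ∈ e → v ∉ f

/-- `M` is a maximal matching of `G`: no edge of `G` outside `M` can be added. -/
def IsMaximalMatching (G : SimpleGraph V) (M : Finset (Sym2 V)) : Prop :=
  IsMatching G M ∧ ∀ e ∈ G.edgeSet, e ∉ M → ¬ IsMatching G (insert e M)

/-- `M` is an induced matching of `G`: a matching such that no edge of `G`
meets two distinct edges of `M`. -/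
def IsInducedMatching (G : SimpleGraph V) (M : Finset (Sym2 V)) : Prop :=
  IsMatching G M ∧ ∀ e ∈ G.edgeSet, ∀ f ∈ M, ∀ g ∈ M, f ≠ g →
    ¬ ((∃ v : V, v ∈ e ∧ v ∈ f) ∧ (∃ v : V, v ∈ e ∧ v ∈ g))

/-- The matching number `match(G)`: maximum size of a matching of `G`. -/
def matchNum (G : SimpleGraph V) : ℕ :=
  sSup {n | ∃ M : Finset (Sym2 V), IsMatching G M ∧ M.card = n}

/-- The minimum matching number `min-match(G)`:
minimum size of a maximal matching of `G`. -/
def minMatchNum (G : SimpleGraph V) : ℕ :=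
  sInf {n | ∃ M : Finset (Sym2 V), IsMaximalMatching G M ∧ M.card = n}

/-- The induced matching number `ind-match(G)`:
maximum size of an induced matching of `G`. -/
def indMatchNum (G : SimpleGraph V) : ℕ :=
  sSup {n | ∃ M : Finset (Sym2 V), IsInducedMatching G M ∧ M.card = n}

/-- The edge ideal `I(G) ⊆ K[x_v : v ∈ V]`, generated by the products
`x_i * x_j` over the edges `{x_i, x_j}` of `G`. -/
def edgeIdeal (K : Type) [Field K] (G : SimpleGraph V) : Ideal (MvPolynomial V K) :=
  Ideal.span {p | ∃ i j : V, G.Adj i j ∧ p = X i * X j}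

/-- `dim(G)`: the Krull dimension of the quotient ring `K[V(G)]/I(G)`. -/
def graphDim (K : Type) [Field K] (G : SimpleGraph V) : WithBot ℕ∞ :=
  ringKrullDim (MvPolynomial V K ⧸ edgeIdeal K G)

/-- The graph of Case 2: a complete graph `K_{2b}` on `v_1, …, v_{2b}` (the
`Sum.inl` vertices, 0-indexed), plus `2(c-b)` further vertices
`x_1, …, x_{2(c-b)}` (the `Sum.inr` vertices, 0-indexed), where each of
`v_1, …, v_b` is joined to each of `x_1, …, x_{c-b}` and each of
`v_{b+1}, …, v_{2b}` is joined to each of `x_{c-b+1}, …, x_{2(c-b)}`. -/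
def caseTwoGraph (b c : ℕ) : SimpleGraph (Fin (2 * b) ⊕ Fin (2 * (c - b))) :=
  SimpleGraph.fromRel (fun u w =>
    (∃ i j : Fin (2 * b), u = Sum.inl i ∧ w = Sum.inl j ∧ i ≠ j) ∨
    (∃ (i : Fin (2 * b)) (m : Fin (2 * (c - b))), u = Sum.inl i ∧ w = Sum.inr m ∧
      (((i : ℕ) < b ∧ (m : ℕ) < c - b) ∨ (b ≤ (i : ℕ) ∧ c - b ≤ (m : ℕ)))))

lemma graphDim_le [Finite V] (K : Type) [Field K] (G : SimpleGraph V) (n : ℕ)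
    (h : ∀ W : Set V, G.IsIndepSet W → Nat.card W ≤ n) : graphDim K G ≤ n := by
  rw [graphDim, ringKrullDim_quotient, Order.krullDim]
  refine iSup_le fun l => ?_
  set p := l.head.1 with hp
  let W : Set V := {v | (X v : MvPolynomial V K) ∉ p.asIdeal}
  have hW : G.IsIndepSet W := by
    intro u hu v hv _ huv
    have hmem : (X u * X v : MvPolynomial V K) ∈ p.asIdeal :=
      l.head.2 (Ideal.subset_span ⟨u, v, huv, rfl⟩)
    exact (p.isPrime.mem_or_mem hmem).elim hu hv
  let φ : MvPolynomial W K →ₐ[K] MvPolynomial V K ⧸ p.asIdeal :=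
    aeval fun w => Ideal.Quotient.mkₐ K p.asIdeal (X (w : V))
  have hφ : Function.Surjective φ := by
    have hle : (⊤ : Subalgebra K (MvPolynomial V K)) ≤
        φ.range.comap (Ideal.Quotient.mkₐ K p.asIdeal) := by
      rw [← MvPolynomial.adjoin_range_X, Algebra.adjoin_le_iff]
      rintro _ ⟨v, rfl⟩
      by_cases hv : (X v : MvPolynomial V K) ∈ p.asIdeal
      · refine ⟨0, ?_⟩
        simpa using (Ideal.Quotient.eq_zero_iff_mem.mpr hv).symm
      · exact ⟨X ⟨v, hv⟩, by simp [φ]⟩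
    intro y
    obtain ⟨q, rfl⟩ := Ideal.Quotient.mk_surjective y
    exact hle (Algebra.mem_top (x := q))
  let l' : LTSeries (PrimeSpectrum.zeroLocus (R := MvPolynomial V K) p.asIdeal) :=
    { length := l.length
      toFun := fun i => ⟨(l i).1, l.head_le i⟩
      step := l.step }
  calc (l.length : WithBot ℕ∞)
      ≤ Order.krullDim (PrimeSpectrum.zeroLocus (R := MvPolynomial V K) p.asIdeal) :=
        le_iSup (fun q : LTSeries _ => (q.length : WithBot ℕ∞)) l'
    _ = ringKrullDim (MvPolynomial V K ⧸ p.asIdeal) := (ringKrullDim_quotient _).symm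
    _ ≤ ringKrullDim (MvPolynomial W K) := ringKrullDim_le_of_surjective φ.toRingHom hφ
    _ = (Nat.card W : ℕ) := by simp [MvPolynomial.ringKrullDim_of_isNoetherianRing]
    _ ≤ n := by exact_mod_cast h W hW

lemma card_le_graphDim [Finite V] (K : Type) [Field K] (G : SimpleGraph V) (W : Set V)
    (hW : G.IsIndepSet W) : (Nat.card W : WithBot ℕ∞) ≤ graphDim K G := by
  let φ : MvPolynomial V K →ₐ[K] MvPolynomial W K :=
    aeval fun v => if h : v ∈ W then X ⟨v, h⟩ else 0
  have hφ : ∀ q ∈ edgeIdeal K G, φ q = 0 := by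
    intro q hq
    refine (Ideal.span_le (I := RingHom.ker φ)).mpr ?_ hq
    rintro _ ⟨i, j, hij, rfl⟩
    simp only [SetLike.mem_coe, RingHom.mem_ker, map_mul, φ, aeval_X]
    by_cases hi : i ∈ W
    · have hj : j ∉ W := fun hj => hW hi hj hij.ne hij
      simp [hj]
    · simp [hi]
  have hsurj : Function.Surjective (Ideal.Quotient.liftₐ (edgeIdeal K G) φ hφ) := by
    apply Ideal.Quotient.lift_surjective_of_surjective
    intro q
    refine ⟨rename (↑) q, ?_⟩
    have hid : φ.comp (rename (↑)) = AlgHom.id K (MvPolynomial W K) := by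
      ext w
      simp [φ]
    exact congrArg (fun ψ : MvPolynomial W K →ₐ[K] MvPolynomial W K => ψ q) hid
  calc (Nat.card W : WithBot ℕ∞) = ringKrullDim (MvPolynomial W K) := by
        simp [MvPolynomial.ringKrullDim_of_isNoetherianRing]
    _ ≤ graphDim K G := ringKrullDim_le_of_surjective
        (Ideal.Quotient.liftₐ (edgeIdeal K G) φ hφ).toRingHom hsurj

/-- The vertices met by a set of edges. -/
def coveredVertices (M : Finset (Sym2 V)) : Finset V :=
  M.biUnion Sym2.toFinset

lemma mem_coveredVertices {M : Finset (Sym2 V)} {v : V} :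
    v ∈ coveredVertices M ↔ ∃ e ∈ M, v ∈ e := by
  simp [coveredVertices]

lemma IsMatching.card_coveredVertices {G : SimpleGraph V} {M : Finset (Sym2 V)}
    (hM : IsMatching G M) : (coveredVertices M).card = 2 * M.card := by
  rw [coveredVertices, Finset.card_biUnion, Finset.sum_congr rfl (g := fun _ => 2)]
  · simp [mul_comm]
  · intro e he
    exact Sym2.card_toFinset_of_not_isDiag e (G.not_isDiag_of_mem_edgeSet (hM.1 he))
  · intro e he f hf hef
    refine Finset.disjoint_left.mpr fun v hv hv' => ?_
    exact hM.2 e he f hf hef v (Sym2.mem_toFinset.mp hv) (Sym2.mem_toFinset.mp hv')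

lemma IsMatching.insert {G : SimpleGraph V} {M : Finset (Sym2 V)} (hM : IsMatching G M)
    {e : Sym2 V} (he : e ∈ G.edgeSet) (hcov : ∀ v ∈ e, v ∉ coveredVertices M) :
    IsMatching G (insert e M) := by
  simp only [mem_coveredVertices] at hcov
  refine ⟨?_, ?_⟩
  · rw [Finset.coe_insert]
    exact Set.insert_subset he hM.1
  · intro f hf g hg hfg v hvf hvg
    rcases Finset.mem_insert.mp hf with hfe | hf <;> rcases Finset.mem_insert.mp hg with hge | hg
    · exact hfg (hfe.trans hge.symm)
    · exact hcov v (hfe ▸ hvf) ⟨g, hg, hvg⟩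
    · exact hcov v (hge ▸ hvg) ⟨f, hf, hvf⟩
    · exact hM.2 f hf g hg hfg v hvf hvg

lemma IsMaximalMatching.not_adj {G : SimpleGraph V} {M : Finset (Sym2 V)}
    (hM : IsMaximalMatching G M) {u v : V} (hu : u ∉ coveredVertices M)
    (hv : v ∉ coveredVertices M) : ¬ G.Adj u v := by
  intro huv
  refine hM.2 s(u, v) huv (fun h => hu (mem_coveredVertices.mpr ⟨_, h, by simp⟩))
    (hM.1.insert huv fun w hw => ?_)
  rcases Sym2.mem_iff.mp hw with rfl | rfl <;> assumption

lemma IsMatching.isMaximalMatching {G : SimpleGraph V} {M : Finset (Sym2 V)}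
    (hM : IsMatching G M) (hcov : ∀ e ∈ G.edgeSet, ∃ v ∈ e, v ∈ coveredVertices M) :
    IsMaximalMatching G M := by
  refine ⟨hM, fun e he heM h => ?_⟩
  obtain ⟨v, hve, hv⟩ := hcov e he
  obtain ⟨f, hf, hvf⟩ := mem_coveredVertices.mp hv
  exact h.2 e (by simp) f (by simp [hf]) (fun hef => heM (hef ▸ hf)) v hve hvf

/-- The set of edges joining `f i` to `g i`. -/
def pairing {ι : Type*} [Fintype ι] (f g : ι → V) : Finset (Sym2 V) :=
  Finset.univ.image fun i => s(f i, g i)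

section Pairing

variable {ι : Type*} [Fintype ι] {f g : ι → V}

lemma card_pairing (hf : f.Injective) (hfg : ∀ i j, f i ≠ g j) :
    (pairing f g).card = Fintype.card ι := by
  rw [pairing, Finset.card_image_of_injective _ fun i j hij => ?_, Finset.card_univ]
  rcases Sym2.eq_iff.mp hij with h | h
  · exact hf h.1
  · exact absurd h.1 (hfg i j)

lemma isMatching_pairing {G : SimpleGraph V} (hf : f.Injective) (hg : g.Injective)
    (hfg : ∀ i j, f i ≠ g j) (hadj : ∀ i, G.Adj (f i) (g i)) :
    IsMatching G (pairing f g) := by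
  simp only [IsMatching, pairing, Finset.coe_image, Finset.coe_univ, Set.image_univ,
    Set.range_subset_iff, Finset.mem_image, Finset.mem_univ, true_and]
  refine ⟨hadj, ?_⟩
  rintro _ ⟨i, rfl⟩ _ ⟨j, rfl⟩ hij v hvi hvj
  have hne : i ≠ j := fun h => hij (by rw [h])
  rcases Sym2.mem_iff.mp hvi with rfl | rfl <;> rcases Sym2.mem_iff.mp hvj with h | h
  · exact hne (hf h)
  · exact hfg i j h
  · exact hfg j i h.symm
  · exact hne (hg h)

end Pairing

section CaseTwoGraph

variable {b c : ℕ}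

@[simp]
lemma caseTwoGraph_adj_inl_inl {i j : Fin (2 * b)} :
    (caseTwoGraph b c).Adj (.inl i) (.inl j) ↔ i ≠ j := by
  simp only [caseTwoGraph, SimpleGraph.fromRel_adj]
  aesop

@[simp]
lemma caseTwoGraph_adj_inl_inr {i : Fin (2 * b)} {m : Fin (2 * (c - b))} :
    (caseTwoGraph b c).Adj (.inl i) (.inr m) ↔
      ((i : ℕ) < b ∧ (m : ℕ) < c - b) ∨ (b ≤ (i : ℕ) ∧ c - b ≤ (m : ℕ)) := by
  simp [caseTwoGraph, SimpleGraph.fromRel_adj]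

@[simp]
lemma caseTwoGraph_not_adj_inr_inr {m n : Fin (2 * (c - b))} :
    ¬ (caseTwoGraph b c).Adj (.inr m) (.inr n) := by
  simp [caseTwoGraph, SimpleGraph.fromRel_adj]

lemma exists_inl_mem_of_mem_edgeSet {e : Sym2 (Fin (2 * b) ⊕ Fin (2 * (c - b)))}
    (he : e ∈ (caseTwoGraph b c).edgeSet) : ∃ i, Sum.inl i ∈ e := by
  induction e with
  | _ u v =>
    rcases u with i | m
    · exact ⟨i, by simp⟩
    · rcases v with j | n
      · exact ⟨j, by simp⟩
      · exact absurd he caseTwoGraph_not_adj_inr_inr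

lemma caseTwoGraph_connected (hb : 1 ≤ b) : (caseTwoGraph b c).Connected := by
  have hinl (i j : Fin (2 * b)) : (caseTwoGraph b c).Reachable (.inl i) (.inl j) := by
    by_cases h : i = j
    · rw [h]
    · exact (caseTwoGraph_adj_inl_inl.mpr h).reachable
  have hroot (v) : (caseTwoGraph b c).Reachable (.inl ⟨0, by omega⟩) v := by
    rcases v with i | m
    · exact hinl _ _
    · by_cases hm : (m : ℕ) < c - b
      · exact SimpleGraph.Adj.reachable (by simp; omega)
      · refine (hinl _ ⟨b, by omega⟩).trans (SimpleGraph.Adj.reachable ?_)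
        simp; omega
  exact { preconnected := fun u v => (hroot u).symm.trans (hroot v)
          nonempty := ⟨.inl ⟨0, by omega⟩⟩ }

lemma card_le_one_of_isInducedMatching_caseTwoGraph
    {M : Finset (Sym2 (Fin (2 * b) ⊕ Fin (2 * (c - b))))}
    (hM : IsInducedMatching (caseTwoGraph b c) M) : M.card ≤ 1 := by
  refine Finset.card_le_one.mpr fun e he f hf => ?_
  by_contra hef
  obtain ⟨i, hi⟩ := exists_inl_mem_of_mem_edgeSet (hM.1.1 he)
  obtain ⟨j, hj⟩ := exists_inl_mem_of_mem_edgeSet (hM.1.1 hf)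
  have hij : i ≠ j := by
    rintro rfl
    exact hM.1.2 e he f hf hef _ hi hj
  exact hM.2 s(.inl i, .inl j) (caseTwoGraph_adj_inl_inl.mpr hij) e he f hf hef
    ⟨⟨_, by simp, hi⟩, ⟨_, by simp, hj⟩⟩

lemma indMatchNum_caseTwoGraph (hb : 1 ≤ b) : indMatchNum (caseTwoGraph b c) = 1 := by
  refine IsGreatest.csSup_eq ⟨?_, ?_⟩
  · refine ⟨{s(.inl ⟨0, by omega⟩, .inl ⟨1, by omega⟩)}, ⟨⟨?_, ?_⟩, ?_⟩, by simp⟩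
    · simp
    · simp +contextual
    · simp +contextual
  · rintro _ ⟨M, hM, rfl⟩
    exact card_le_one_of_isInducedMatching_caseTwoGraph hM

lemma le_card_of_isMaximalMatching_caseTwoGraph
    {M : Finset (Sym2 (Fin (2 * b) ⊕ Fin (2 * (c - b))))}
    (hM : IsMaximalMatching (caseTwoGraph b c) M) : b ≤ M.card := by
  by_contra! hlt
  have hcard := hM.1.card_coveredVertices
  let A : Finset (Fin (2 * b) ⊕ Fin (2 * (c - b))) := Finset.univ.map .inl
  have hA : A.card = 2 * b := by simp [A]
  have hdiff := Finset.le_card_sdiff (coveredVertices M) A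
  obtain ⟨u, hu, v, hv, huv⟩ :=
    Finset.one_lt_card.mp (show 1 < (A \ coveredVertices M).card by omega)
  simp only [A, Finset.mem_sdiff, Finset.mem_map, Finset.mem_univ, true_and,
    Function.Embedding.inl_apply] at hu hv
  obtain ⟨⟨i, rfl⟩, hu⟩ := hu
  obtain ⟨⟨j, rfl⟩, hv⟩ := hv
  exact hM.not_adj hu hv (caseTwoGraph_adj_inl_inl.mpr fun h => huv (by rw [h]))

lemma minMatchNum_caseTwoGraph : minMatchNum (caseTwoGraph b c) = b := by
  refine IsLeast.csInf_eq ⟨?_, ?_⟩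
  · let f : Fin b → Fin (2 * b) ⊕ Fin (2 * (c - b)) := fun i => .inl ⟨i, by omega⟩
    let g : Fin b → Fin (2 * b) ⊕ Fin (2 * (c - b)) := fun i => .inl ⟨b + i, by omega⟩
    have hf : f.Injective := fun i j h => by simpa [f, Fin.ext_iff] using h
    have hg : g.Injective := fun i j h => by simpa [g, Fin.ext_iff] using h
    have hfg (i j) : f i ≠ g j := by simp [f, g]; omega
    refine ⟨pairing f g, (isMatching_pairing hf hg hfg fun i => ?_).isMaximalMatching ?_, ?_⟩
    · have := i.isLt
      simp [f, g]; omega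
    · intro e he
      obtain ⟨i, hi⟩ := exists_inl_mem_of_mem_edgeSet he
      refine ⟨_, hi, mem_coveredVertices.mpr ?_⟩
      simp only [pairing, Finset.mem_image, Finset.mem_univ, true_and, exists_exists_eq_and,
        Sym2.mem_iff]
      by_cases hib : (i : ℕ) < b
      · exact ⟨⟨i, hib⟩, .inl rfl⟩
      · refine ⟨⟨i - b, by omega⟩, .inr ?_⟩
        simp only [g, Sum.inl.injEq, Fin.ext_iff]
        omega
    · simp [card_pairing hf hfg]
  · rintro _ ⟨M, hM, rfl⟩
    exact le_card_of_isMaximalMatching_caseTwoGraph hM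

lemma matchNum_caseTwoGraph (hbc : b < c) (hc : c ≤ 2 * b) :
    matchNum (caseTwoGraph b c) = c := by
  refine IsGreatest.csSup_eq ⟨?_, ?_⟩
  · let f : Fin (c - b) ⊕ Fin b → Fin (2 * b) ⊕ Fin (2 * (c - b)) :=
      Sum.elim (fun l => .inr ⟨l, by omega⟩) fun j =>
        if h : (j : ℕ) < c - b then .inr ⟨c - b + j, by omega⟩ else .inl ⟨j, by omega⟩
    let g : Fin (c - b) ⊕ Fin b → Fin (2 * b) ⊕ Fin (2 * (c - b)) :=
      Sum.elim (fun l => .inl ⟨l, by omega⟩) fun j => .inl ⟨b + j, by omega⟩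
    have hf : f.Injective := by
      rintro (i | i) (j | j) <;> simp only [f, Sum.elim_inl, Sum.elim_inr] <;> (try split_ifs) <;>
        simp [Fin.ext_iff] <;> omega
    have hg : g.Injective := by
      rintro (i | i) (j | j) <;> simp [g, Fin.ext_iff] <;> omega
    have hfg (i j) : f i ≠ g j := by
      rcases i with i | i <;> rcases j with j | j <;>
        simp only [f, g, Sum.elim_inl, Sum.elim_inr] <;> (try split_ifs) <;> simp <;> omega
    refine ⟨pairing f g, isMatching_pairing hf hg hfg ?_, ?_⟩
    · rintro (i | i) <;> simp only [f, g, Sum.elim_inl, Sum.elim_inr] <;> (try split_ifs) <;>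
        rw [SimpleGraph.adj_comm] <;> simp <;> omega
    · rw [card_pairing hf hfg]
      simp
      omega
  · rintro _ ⟨M, hM, rfl⟩
    have hle := Finset.card_le_univ (coveredVertices M)
    rw [hM.card_coveredVertices] at hle
    simp only [Fintype.card_sum, Fintype.card_fin] at hle
    omega

lemma card_le_of_isIndepSet_caseTwoGraph (hbc : b < c)
    {W : Set (Fin (2 * b) ⊕ Fin (2 * (c - b)))} (hW : (caseTwoGraph b c).IsIndepSet W) :
    Nat.card W ≤ 2 * (c - b) := by
  -- Send a `v`-vertex to the index of one of its `x`-neighbours, which cannot lie in `W`.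
  let φ : Fin (2 * b) ⊕ Fin (2 * (c - b)) → Fin (2 * (c - b)) :=
    Sum.elim (fun i => if (i : ℕ) < b then ⟨0, by omega⟩ else ⟨c - b, by omega⟩) id
  have hnbr (i : Fin (2 * b)) : (caseTwoGraph b c).Adj (.inl i) (.inr (φ (.inl i))) := by
    simp only [φ, Sum.elim_inl]
    split_ifs <;> simp <;> omega
  have hφ : Set.InjOn φ W := by
    rintro (i | m) hu (j | n) hv h
    · by_contra hij
      exact hW hu hv hij (by simpa using hij)
    · have hn : φ (.inl i) = n := h
      exact absurd (hn ▸ hnbr i) (hW hu hv (by simp))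
    · have hm : φ (.inl j) = m := h.symm
      exact absurd (hm ▸ hnbr j) (hW hv hu (by simp))
    · exact congrArg _ h
  simpa using Nat.card_le_card_of_injective (W.domRestrict φ) hφ.injective

lemma graphDim_caseTwoGraph (hbc : b < c) (K : Type) [Field K] :
    graphDim K (caseTwoGraph b c) = ((2 * (c - b) : ℕ) : WithBot ℕ∞) := by
  refine le_antisymm (graphDim_le K _ _ fun W hW => card_le_of_isIndepSet_caseTwoGraph hbc hW) ?_
  have hindep : (caseTwoGraph b c).IsIndepSet (Set.range Sum.inr) := by
    rintro _ ⟨m, rfl⟩ _ ⟨n, rfl⟩ _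
    exact caseTwoGraph_not_adj_inr_inr
  have hcard : Nat.card (Set.range (Sum.inr : _ → Fin (2 * b) ⊕ Fin (2 * (c - b)))) =
      2 * (c - b) := by
    rw [Nat.card_range_of_injective Sum.inr_injective, Nat.card_fin]
  rw [← Nat.cast_inj (R := WithBot ℕ∞)] at hcard
  exact hcard.ge.trans (card_le_graphDim K _ _ hindep)

end CaseTwoGraph

/-- For `1 ≤ b < c ≤ 2b`, the graph `caseTwoGraph b c` is connected and has
`ind-match = 1`, `min-match = b`, `match = c` and `dim = 2(c - b)`. -/
theorem caseTwoGraph_invariants (b c : ℕ) (hb : 1 ≤ b) (hbc : b < c)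
    (hc : c ≤ 2 * b) (K : Type) [Field K] :
    (caseTwoGraph b c).Connected ∧ indMatchNum (caseTwoGraph b c) = 1 ∧
      minMatchNum (caseTwoGraph b c) = b ∧ matchNum (caseTwoGraph b c) = c ∧
      graphDim K (caseTwoGraph b c) = ((2 * (c - b) : ℕ) : WithBot ℕ∞) :=
  ⟨caseTwoGraph_connected hb, indMatchNum_caseTwoGraph hb, minMatchNum_caseTwoGraph,
    matchNum_caseTwoGraph hbc hc, graphDim_caseTwoGraph hbc K⟩

end EdgeIdealPaper
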